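/- arXiv:1903.04380 — 3 statements merged into one kernel-verified Lean document; each statement's English description precedes it below -/
import Mathlib

section
/- For every n ≥ 1 and every k with 1 ≤ k ≤ ⌈n/2⌉, the complete graph K_n admits a balanced Gallai k-coloring, that is, a Gallai coloring with k colors in which the sizes of any two color classes differ by at most 1. -/
/-- An edge coloring of `K_n` (edges = non-diagonal elements of `Sym2 (Fin n)`)
is a Gallai coloring if no triangle receives three pairwise distinct colors. -/
def IsGallai {n : ℕ} {C : Type*} (c : Sym2 (Fin n) → C) : Prop :=
  ∀ a b d : Fin n, a ≠ b → b ≠ d → a ≠ d →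
    c s(a, b) = c s(b, d) ∨ c s(b, d) = c s(a, d) ∨ c s(a, b) = c s(a, d)

/-- The number of edges of `K_n` receiving color `i`. -/
def colorCard {n : ℕ} {C : Type*} [DecidableEq C] (c : Sym2 (Fin n) → C) (i : C) : ℕ :=
  (Finset.univ.filter (fun e : Sym2 (Fin n) => ¬ e.IsDiag ∧ c e = i)).card

/-- Disjoint sub-multisets of `A` with sums `M`. -/
def GPack (A M : Multiset ℕ) : Prop :=
  ∃ L : Multiset (Multiset ℕ), L.sum ≤ A ∧ L.map Multiset.sum = M

/-- The integers in `[a,b)`. -/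
def GI (a b : ℕ) : Multiset ℕ := (Finset.Ico a b).val

lemma GI_add {a b c : ℕ} (h : a ≤ b) (h' : b ≤ c) : GI a b + GI b c = GI a c := by
  unfold GI
  rw [← Finset.Ico_union_Ico_eq_Ico h h', ← Finset.disjUnion_eq_union _ _ (Finset.Ico_disjoint_Ico_consecutive a b c)]
  rfl

lemma GI_single (a : ℕ) : GI a (a+1) = {a} := by
  unfold GI; simp

lemma GI_sum (n : ℕ) : 2 * (GI 1 (n+1)).sum = n * (n+1) := by
  induction n with
  | zero => simp [GI]
  | succ n ih =>
    rw [← GI_add (b := n+1) (by omega) (by omega), GI_single, Multiset.sum_add, Multiset.sum_singleton, mul_add, ih]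
    ring

namespace GPack

lemma nil (A) : GPack A 0 := ⟨0, by simp, by simp⟩

lemma mono {A B M} (h : GPack A M) (hAB : A ≤ B) : GPack B M := by
  obtain ⟨L, h1, h2⟩ := h
  exact ⟨L, h1.trans hAB, h2⟩

lemma add {A B M N} (h : GPack A M) (h' : GPack B N) : GPack (A + B) (M + N) := by
  obtain ⟨L, h1, h2⟩ := h
  obtain ⟨L', h1', h2'⟩ := h'
  exact ⟨L + L', by rw [Multiset.sum_add]; exact add_le_add h1 h1', by rw [Multiset.map_add, h2, h2']⟩

lemma self (A) : GPack A {A.sum} := ⟨{A}, by simp, by simp⟩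

lemma tail {A M a} (h : GPack A (a ::ₘ M)) : GPack A M := by
  obtain ⟨L, h1, h2⟩ := h
  obtain ⟨x, hx, hxa, hL⟩ := Multiset.map_eq_cons _ _ _ _ |>.mpr h2
  refine ⟨L.erase x, ?_, hL⟩
  rw [← Multiset.cons_erase hx, Multiset.sum_cons] at h1
  exact (Multiset.le_add_left _ _).trans h1

lemma left {A M N} (h : GPack A (M + N)) : GPack A M := by
  induction N using Multiset.induction with
  | empty => simpa using h
  | cons a N ih => rw [Multiset.add_cons] at h; exact ih h.tail

lemma merge {A M a b} (h : GPack A (a ::ₘ b ::ₘ M)) : GPack A ((a + b) ::ₘ M) := by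
  obtain ⟨L, h1, h2⟩ := h
  obtain ⟨x, hx, hxa, hL⟩ := Multiset.map_eq_cons _ _ _ _ |>.mpr h2
  obtain ⟨y, hy, hyb, hL'⟩ := Multiset.map_eq_cons _ _ _ _ |>.mpr hL
  refine ⟨(x + y) ::ₘ (L.erase x).erase y, ?_, ?_⟩
  · rw [← Multiset.cons_erase hx, ← Multiset.cons_erase hy, Multiset.sum_cons, Multiset.sum_cons] at h1
    rw [Multiset.sum_cons, add_assoc]; exact h1
  · rw [Multiset.map_cons, hL', Multiset.sum_add, hxa, hyb]

lemma mergeRep {A M a b} (K : ℕ) (h : GPack A (Multiset.replicate K a + Multiset.replicate K b + M)) :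
    GPack A (Multiset.replicate K (a+b) + M) := by
  induction K generalizing M with
  | zero => simpa using h
  | succ K ih =>
    have : GPack A (a ::ₘ b ::ₘ (Multiset.replicate K a + Multiset.replicate K b + M)) := by
      convert h using 1
      simp only [Multiset.replicate_succ, Multiset.cons_add, Multiset.add_cons]
      exact Multiset.cons_swap _ _ _
    have := this.merge
    rw [← Multiset.add_cons] at this
    have := ih this
    simpa only [Multiset.replicate_succ, Multiset.cons_add, Multiset.add_cons] using this

lemma rest {A M} (h : GPack A M) (z : ℕ) (hz : A.sum = z + M.sum) : GPack A (z ::ₘ M) := by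
  obtain ⟨L, h1, h2⟩ := h
  obtain ⟨B, rfl⟩ := Multiset.le_iff_exists_add.mp h1
  refine ⟨B ::ₘ L, by rw [Multiset.sum_cons, add_comm], ?_⟩
  have : L.sum.sum = M.sum := by
    rw [← h2]
    clear h2 h1 hz
    induction L using Multiset.induction with
    | empty => simp
    | cons a L ih => simp [ih]
  rw [Multiset.sum_add, this] at hz
  rw [Multiset.map_cons, h2]
  congr 1
  omega

lemma zeros (A) (K : ℕ) : GPack A (Multiset.replicate K 0) :=
  ⟨Multiset.replicate K 0, by simp, by simp⟩

lemma pairs (t a b c : ℕ) (hc : c + 1 = a + b + t) :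
    GPack (GI a (a+t) + GI b (b+t)) (Multiset.replicate t c) := by
  induction t generalizing a with
  | zero => exact nil _
  | succ t ih =>
    have h := ih (a+1) (by omega)
    have h2 := (self ({a} + {b+t})).add h
    rw [← GI_add (a := a) (b := a+1) (by omega) (by omega), ← GI_add (a := b) (b := b+t) (by omega) (by omega),
      show b + (t+1) = b+t+1 by ring, GI_single, GI_single, show a + (t+1) = a+1+t by ring]
    convert h2 using 1
    · abel
    · simp only [Multiset.replicate_succ, Multiset.singleton_add]
      congr 1; simp; omega

/-- `pairs` with explicit end points -/
lemma pairs' {a a' b b' t c : ℕ} (ha : a' = a + t) (hb : b' = b + t) (hc : c + 1 = a + b + t) :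
    GPack (GI a a' + GI b b') (Multiset.replicate t c) := by
  subst ha hb; exact pairs t a b c hc

end GPack
open Multiset in
lemma gE (n : ℕ) : ∀ K s : ℕ, n ≤ s → 2 * (K * s) ≤ n * (n+1) →
    GPack (GI 1 (n+1)) (replicate K s) := by
  induction n using Nat.strong_induction_on with
  | _ n ih =>
  intro K s hns hK
  rcases Nat.eq_zero_or_pos K with rfl | hKpos
  · exact GPack.nil _
  rcases Nat.eq_zero_or_pos n with rfl | hn
  · have : s = 0 := by
      have : K * s = 0 := by omega
      rcases Nat.mul_eq_zero.mp this with h | h <;> omega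
    subst this; exact GPack.zeros _ _
  rcases hns.eq_or_lt with rfl | hlt
  · obtain ⟨m, rfl⟩ := Nat.exists_eq_add_of_lt hn
    obtain ⟨K, rfl⟩ := Nat.exists_eq_add_of_lt hKpos
    simp only [zero_add] at *
    have h := ih m (by omega) K (m+1) (by omega) (by nlinarith)
    have h2 := (GPack.self {m+1}).add h
    rw [← GI_add (b := m+1) (by omega) (by omega), GI_single, add_comm]
    simpa only [replicate_succ, singleton_add, sum_singleton] using h2
  rcases lt_or_ge s (2*n) with h2n | h2n
  · obtain ⟨d, rfl⟩ := Nat.exists_eq_add_of_lt hlt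
    obtain ⟨c, hc | hc⟩ := Nat.even_or_odd' (n + d + 1)
    · obtain ⟨P, rfl⟩ : ∃ P, n = c + P := ⟨n - c, by omega⟩
      have hp : GPack (GI (d+1) c + GI (c+1) (c+P+1)) (replicate P (c+P+d+1)) :=
        GPack.pairs' (by omega) (by omega) (by omega)
      have e : GI 1 (c+P+1) = (GI (d+1) c + GI (c+1) (c+P+1)) + (GI 1 (d+1) + {c}) := by
        rw [← GI_add (a := 1) (b := d+1) (by omega) (by omega), ← GI_add (a := d+1) (b := c) (by omega) (by omega),
          ← GI_add (a := c) (b := c+1) (by omega) (by omega), GI_single]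
        abel
      rw [e]
      rcases le_or_gt K P with hKP | hKP
      · obtain ⟨x, rfl⟩ := Nat.exists_eq_add_of_le hKP
        rw [replicate_add] at hp
        exact hp.left.mono (Multiset.le_add_right _ _)
      · obtain ⟨x, rfl⟩ := Nat.exists_eq_add_of_lt hKP
        have h := ih d (by omega) (2*x+1) c (by omega) (by
          rw [hc] at hK
          obtain rfl : c = P + d + 1 := by omega
          nlinarith)
        have h2 := h.add (GPack.self {c})
        have h3 : GPack (GI 1 (d+1) + {c}) (replicate (x+1) (c+c) + 0) := by
          apply GPack.mergeRep
          convert h2 using 1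
          rw [add_zero, ← replicate_add, sum_singleton, ← replicate_one, ← replicate_add]
          congr 1; ring
        rw [add_zero] at h3
        have h4 := hp.add h3
        rw [show c + c = c + P + d + 1 by omega, ← replicate_add] at h4
        exact h4
    · obtain ⟨P, rfl⟩ : ∃ P, n = c + P := ⟨n - c, by omega⟩
      have hp : GPack (GI (d+1) (c+1) + GI (c+1) (c+P+1)) (replicate P (c+P+d+1)) :=
        GPack.pairs' (by omega) (by omega) (by omega)
      have e : GI 1 (c+P+1) = (GI (d+1) (c+1) + GI (c+1) (c+P+1)) + (GI 1 (d+1)) := by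
        rw [← GI_add (a := 1) (b := d+1) (by omega) (by omega), ← GI_add (a := d+1) (b := c+1) (by omega) (by omega)]
        abel
      rw [e]
      rcases le_or_gt K P with hKP | hKP
      · obtain ⟨x, rfl⟩ := Nat.exists_eq_add_of_le hKP
        rw [replicate_add] at hp
        exact hp.left.mono (Multiset.le_add_right _ _)
      · obtain ⟨x, rfl⟩ := Nat.exists_eq_add_of_le hKP.le
        have h := ih d (by omega) x (c+P+d+1) (by omega) (by
          obtain rfl : c = P + d := by omega
          nlinarith)
        rw [replicate_add]
        exact hp.add h
  · have h4 : 4 * K ≤ n + 1 := by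
      have : n * (4 * K) ≤ n * (n+1) := by nlinarith
      exact Nat.le_of_mul_le_mul_left this hn
    obtain ⟨m, rfl⟩ : ∃ m, n = m + 2 * K := ⟨n - 2*K, by omega⟩
    obtain ⟨r, rfl⟩ : ∃ r, s = r + (2*m+2*K+1) := ⟨s - (2*m+2*K+1), by omega⟩
    have hp : GPack (GI (m+1) (m+K+1) + GI (m+K+1) (m+2*K+1)) (replicate K (2*m+2*K+1)) :=
      GPack.pairs' (by omega) (by omega) (by omega)
    rw [GI_add (by omega) (by omega)] at hp
    have hq : GPack (GI 1 (m+1)) (replicate K r) := by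
      rcases le_or_gt m r with hmr | hmr
      · exact ih m (by omega) K r hmr (by nlinarith)
      · have := ih r (by omega) K r le_rfl (by nlinarith)
        refine this.mono ?_
        rw [← GI_add (a := 1) (b := r+1) (c := m+1) (by omega) (by omega)]
        exact Multiset.le_add_right _ _
    have h3 := hq.add hp
    rw [GI_add (by omega) (by omega)] at h3
    have := GPack.mergeRep (M := 0) K (by simpa using h3)
    simpa using this

open Multiset in
lemma gBal (n : ℕ) : ∀ q p s : ℕ, n ≤ s → 2 * (q * s + p * (s+1)) = n * (n+1) →
    GPack (GI 1 (n+1)) (replicate q s + replicate p (s+1)) := by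
  induction n using Nat.strong_induction_on with
  | _ n ih =>
  intro q p s hns hT
  rcases Nat.eq_zero_or_pos q with rfl | hq
  · have := gE n p (s+1) (by omega) (by nlinarith)
    simpa using this
  rcases Nat.eq_zero_or_pos p with rfl | hp
  · have := gE n q s (by omega) (by nlinarith)
    simpa using this
  rcases Nat.eq_zero_or_pos n with rfl | hn
  · exfalso; nlinarith
  rcases hns.eq_or_lt with rfl | hlt
  · obtain ⟨m, rfl⟩ := Nat.exists_eq_add_of_lt hn
    obtain ⟨q, rfl⟩ := Nat.exists_eq_add_of_lt hq
    simp only [zero_add] at *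
    have h := ih m (by omega) q p (m+1) (by omega) (by nlinarith)
    have h2 := (GPack.self {m+1}).add h
    rw [← GI_add (b := m+1) (by omega) (by omega), GI_single, add_comm]
    simpa only [replicate_succ, singleton_add, sum_singleton, cons_add] using h2
  rcases lt_or_ge s (2*n) with h2n | h2n
  · obtain ⟨d, rfl⟩ := Nat.exists_eq_add_of_lt hlt
    obtain ⟨c, hc | hc⟩ := Nat.even_or_odd' (n + d + 1)
    · obtain ⟨P, rfl⟩ : ∃ P, n = c + P := ⟨n - c, by omega⟩
      obtain rfl : c = P + d + 1 := by omega
      rcases le_or_gt P p with hP | hP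
      · obtain ⟨x, rfl⟩ := Nat.exists_eq_add_of_le hP
        have h1 : GPack (GI (d+2) (P+d+1+1) + GI (P+d+1+1) (P+d+1+P+1)) (replicate P (P+d+1+P+d+1+1)) :=
          GPack.pairs' (by omega) (by omega) (by omega)
        rw [GI_add (by omega) (by omega)] at h1
        have h2 := ih (d+1) (by omega) q x (P+d+1+P+d+1) (by omega) (by nlinarith)
        have h3 := h2.add h1
        rw [GI_add (by omega) (by omega)] at h3
        rw [add_comm P x, replicate_add, ← add_assoc]
        exact h3
      · obtain ⟨t, rfl⟩ := Nat.exists_eq_add_of_lt hP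
        -- t+1 outer pairs of sum s, p inner pairs of sum s+1
        have key : t + 1 < q := by
          by_contra hcon
          push Not at hcon
          have := Nat.mul_le_mul_right (p+t+1+d+1+(p+t+1)+d+1) hcon
          nlinarith
        obtain ⟨x, rfl⟩ := Nat.exists_eq_add_of_lt key
        set s := p+t+1+d+1+(p+t+1)+d+1 with hs
        have h1 : GPack (GI (d+1) (d+t+2) + GI (2*p+t+d+3) (2*p+2*t+d+4)) (replicate (t+1) s) :=
          GPack.pairs' (by omega) (by omega) (by omega)
        have h2 : GPack (GI (d+t+3) (p+t+d+3) + GI (p+t+d+3) (2*p+t+d+3)) (replicate p (s+1)) :=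
          GPack.pairs' (by omega) (by omega) (by omega)
        have h3 := gE d x s (by omega) (by rw [hs] at hT ⊢; nlinarith)
        have h4 := h3.rest (2*p+t+d+2) (by
          have := GI_sum d
          rw [sum_replicate, smul_eq_mul]
          rw [hs] at hT ⊢; nlinarith)
        have h5 : GPack (GI 1 (d+1) + {d+t+2}) (replicate (x+1) s) := by
          have := (GPack.self {d+t+2}).add h4
          rw [sum_singleton, singleton_add _ (_ ::ₘ _)] at this
          have := this.merge
          rw [show d+t+2 + (2*p+t+d+2) = s by omega, ← replicate_succ, add_comm] at this
          exact this
        have h6 := (h1.add h2).add h5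
        convert h6 using 1
        · rw [show p+t+1+d+1+(p+t+1)+1 = 2*p+2*t+d+4 by ring]
          rw [← GI_add (a := 1) (b := d+1) (by omega) (by omega), ← GI_add (a := d+1) (b := d+t+2) (by omega) (by omega),
            ← GI_add (a := d+t+2) (b := d+t+3) (by omega) (by omega), GI_single,
            ← GI_add (a := d+t+3) (b := p+t+d+3) (by omega) (by omega),
            ← GI_add (a := p+t+d+3) (b := 2*p+t+d+3) (by omega) (by omega)]
          abel
        · rw [show t+1+x+1 = (t+1)+(x+1) by ring, replicate_add]
          abel
    · obtain ⟨P, rfl⟩ : ∃ P, n = c + P := ⟨n - c, by omega⟩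
      obtain rfl : c = P + d := by omega
      rcases le_or_gt P q with hP | hP
      · obtain ⟨x, rfl⟩ := Nat.exists_eq_add_of_le hP
        have h1 : GPack (GI (d+1) (P+d+1) + GI (P+d+1) (P+d+P+1)) (replicate P (P+d+P+d+1)) :=
          GPack.pairs' (by omega) (by omega) (by omega)
        rw [GI_add (by omega) (by omega)] at h1
        have h2 := ih d (by omega) x p (P+d+P+d+1) (by omega) (by nlinarith)
        have h3 := h1.add h2
        rw [add_comm (GI _ _), GI_add (by omega) (by omega)] at h3
        rw [replicate_add, add_assoc (replicate P _)]
        exact h3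
      · obtain ⟨u, rfl⟩ := Nat.exists_eq_add_of_lt hP
        have key : u < p := by
          by_contra hcon
          push Not at hcon
          have := Nat.mul_le_mul_right (q+u+1+d+(q+u+1)+d+1+1) hcon
          nlinarith
        obtain ⟨x, rfl⟩ := Nat.exists_eq_add_of_lt key
        set s := q+u+1+d+(q+u+1)+d+1 with hs
        have h1 : GPack (GI (d+1) (d+q+1) + GI (q+2*u+d+3) (2*q+2*u+d+3)) (replicate q s) :=
          GPack.pairs' (by omega) (by omega) (by omega)
        have h2 : GPack (GI (d+q+2) (d+q+u+2) + GI (d+q+u+3) (q+2*u+d+3)) (replicate u (s+1)) :=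
          GPack.pairs' (by omega) (by omega) (by omega)
        have h3 := gE d x (s+1) (by omega) (by rw [hs] at hT ⊢; nlinarith)
        have h4 := h3.rest (u+1) (by
          have := GI_sum d
          rw [sum_replicate, smul_eq_mul]
          rw [hs] at hT ⊢; nlinarith)
        have h5 : GPack (GI 1 (d+1) + {d+q+1, d+q+u+2}) (replicate (x+1) (s+1)) := by
          have := (GPack.self {d+q+1, d+q+u+2}).add h4
          rw [singleton_add] at this
          have := this.merge
          rw [show ({d+q+1, d+q+u+2} : Multiset ℕ).sum + (u+1) = s+1 by simp; omega, ← replicate_succ, add_comm] at this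
          exact this
        have h6 := (h1.add h2).add h5
        convert h6 using 1
        · rw [show q+u+1+d+(q+u+1)+1 = 2*q+2*u+d+3 by ring]
          rw [← GI_add (a := 1) (b := d+1) (by omega) (by omega), ← GI_add (a := d+1) (b := d+q+1) (by omega) (by omega),
            ← GI_add (a := d+q+1) (b := d+q+2) (by omega) (by omega), GI_single,
            ← GI_add (a := d+q+2) (b := d+q+u+2) (by omega) (by omega),
            ← GI_add (a := d+q+u+2) (b := d+q+u+3) (by omega) (by omega), GI_single,
            ← GI_add (a := d+q+u+3) (b := q+2*u+d+3) (by omega) (by omega),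
            show ({d+q+1, d+q+u+2} : Multiset ℕ) = {d+q+1} + {d+q+u+2} from rfl]
          abel
        · rw [show u+x+1 = u+(x+1) by ring, replicate_add]
          abel
  · have h4 : 4 * (q+p) ≤ n + 1 := by
      have : n * (4 * (q+p)) ≤ n * (n+1) := by nlinarith
      exact Nat.le_of_mul_le_mul_left this hn
    obtain ⟨m, rfl⟩ : ∃ m, n = m + 2 * (q+p) := ⟨n - 2*(q+p), by omega⟩
    obtain ⟨r, rfl⟩ : ∃ r, s = r + (2*m+2*(q+p)+1) := ⟨s - (2*m+2*(q+p)+1), by omega⟩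
    have hp1 : GPack (GI (m+1) (m+(q+p)+1) + GI (m+(q+p)+1) (m+2*(q+p)+1)) (replicate (q+p) (2*m+2*(q+p)+1)) :=
      GPack.pairs' (by omega) (by omega) (by omega)
    rw [GI_add (by omega) (by omega)] at hp1
    have hT' : 2 * (q * r + p * (r+1)) = m * (m+1) := by nlinarith
    have hmr : m ≤ r := by
      by_contra hcon
      push Not at hcon
      have h5 : 2*(q+p) ≤ r + 1 := by omega
      have : m * (m+1) ≤ 2 * (q+p) * (r+1) := by nlinarith
      nlinarith
    have hq1 := ih m (by omega) q p r hmr hT'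
    have h3 := hq1.add hp1
    rw [GI_add (by omega) (by omega), replicate_add] at h3
    have h6 := GPack.mergeRep (A := GI 1 (m+2*(q+p)+1)) (a := r) (b := 2*m+2*(q+p)+1)
      (M := replicate p (r+1) + replicate p (2*m+2*(q+p)+1)) q (by convert h3 using 1; abel)
    have h7 := GPack.mergeRep (A := GI 1 (m+2*(q+p)+1)) (a := r+1) (b := 2*m+2*(q+p)+1)
      (M := replicate q (r + (2*m+2*(q+p)+1))) p (by convert h6 using 1; abel)
    rw [add_comm (replicate p _)] at h7
    rw [show r + (2*m+2*(q+p)+1) + 1 = r + 1 + (2*m+2*(q+p)+1) by ring]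
    exact h7

lemma gToFun (L : List (Multiset ℕ)) : ∀ A : Multiset ℕ, A.Nodup → L.sum = A →
    ∃ f : ℕ → ℕ, (∀ x ∈ A, f x < L.length) ∧
      ∀ i (h : i < L.length), A.filter (fun x => f x = i) = L[i] := by
  induction L with
  | nil => intro A _ h; subst h; exact ⟨id, by simp, by simp⟩
  | cons S L ih =>
    intro A hA h
    rw [List.sum_cons] at h
    subst h
    obtain ⟨hS, hL, hd⟩ := Multiset.nodup_add.mp hA
    obtain ⟨f, hf1, hf2⟩ := ih L.sum hL rfl
    have hne : ∀ x ∈ L.sum, x ∉ S := fun x hx hxS => Multiset.disjoint_left.mp hd hxS hx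
    refine ⟨fun x => if x ∈ S then 0 else f x + 1, ?_, ?_⟩
    · intro x hx
      by_cases hxS : x ∈ S
      · simp [hxS]
      · have : x ∈ L.sum := (Multiset.mem_add.mp hx).resolve_left hxS
        simpa [hxS] using hf1 x this
    · intro i hi
      rw [Multiset.filter_add]
      cases i with
      | zero =>
        rw [Multiset.filter_eq_self.mpr (by intro x hx; simp [hx]),
          Multiset.filter_eq_nil.mpr (by intro x hx; simp [hne x hx])]
        simp
      | succ i =>
        rw [Multiset.filter_eq_nil.mpr (by intro x hx; simp [hx]), zero_add]
        rw [List.getElem_cons_succ, ← hf2 i (by simpa using hi)]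
        apply Multiset.filter_congr
        intro x hx
        simp [hne x hx]

lemma gFun {n : ℕ} {M : Multiset ℕ} (h : GPack (GI 1 n) M) (hs : (GI 1 n).sum = M.sum) :
    ∃ f : ℕ → ℕ, (∀ x ∈ Finset.Ico 1 n, f x < M.card) ∧
      ∀ i < M.card, ∑ x ∈ Finset.Ico 1 n, (if f x = i then x else 0) ∈ M := by
  obtain ⟨L, h1, h2⟩ := h
  have hsum : L.sum = GI 1 n := by
    obtain ⟨B, hB⟩ := Multiset.le_iff_exists_add.mp h1
    have h3 : L.sum.sum = M.sum := by
      rw [← h2]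
      clear h2 h1 hB
      induction L using Multiset.induction with
      | empty => simp
      | cons a L ih => simp [ih]
    have h4 : B.sum = 0 := by
      rw [hB, Multiset.sum_add] at hs; omega
    have h5 : B = 0 := by
      rw [Multiset.eq_zero_iff_forall_notMem]
      intro x hx
      have hx0 : x = 0 := by
        have := Multiset.le_sum_of_mem hx
        omega
      have : x ∈ GI 1 n := by rw [hB]; exact Multiset.mem_add.mpr (Or.inr hx)
      have := Finset.mem_Ico.mp (Finset.mem_val.mp this)
      omega
    rw [hB, h5, add_zero]
  obtain ⟨l, rfl⟩ := Quot.exists_rep L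
  change Multiset.map Multiset.sum (l : Multiset (Multiset ℕ)) = M at h2
  change (l : Multiset (Multiset ℕ)).sum = _ at hsum
  rw [Multiset.sum_coe] at hsum
  obtain ⟨f, hf1, hf2⟩ := gToFun l (GI 1 n) (Finset.nodup _) hsum
  have hcard : M.card = l.length := by rw [← h2]; simp
  refine ⟨f, fun x hx => hcard ▸ hf1 x hx, fun i hi => ?_⟩
  rw [hcard] at hi
  have h6 := hf2 i hi
  rw [← Finset.sum_filter, ← h2]
  refine Multiset.mem_map.mpr ⟨l[i], by simp, ?_⟩
  rw [← h6, Finset.sum_eq_multiset_sum, Finset.filter_val, Multiset.map_id']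
  rfl

/-- The coloring where each edge takes the color of its larger end point. -/
def gCol {n : ℕ} {C : Type*} (g : Fin n → C) : Sym2 (Fin n) → C :=
  Sym2.lift ⟨fun a b => g (max a b), fun a b => by simp only [max_comm]⟩

lemma gCol_gallai {n : ℕ} {C : Type*} (g : Fin n → C) : IsGallai (gCol g) := by
  intro a b d _ _ _
  simp only [gCol, Sym2.lift_mk]
  rcases le_total a b with h1 | h1 <;> rcases le_total b d with h2 | h2 <;>
    rcases le_total a d with h3 | h3 <;>
    first | (exfalso; omega) | simp [h1, h2, h3]

lemma gCol_card {n : ℕ} {C : Type*} [DecidableEq C] (g : Fin n → C) (i : C) :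
    colorCard (gCol g) i = ∑ v : Fin n, if g v = i then (v : ℕ) else 0 := by
  have h1 : colorCard (gCol g) i =
      (Finset.univ.filter (fun p : Fin n × Fin n => p.1 < p.2 ∧ g p.2 = i)).card := by
    symm
    apply Finset.card_bij (fun p _ => s(p.1, p.2))
    · rintro ⟨a, b⟩ hp
      simp only [Finset.mem_filter, Finset.mem_univ, true_and] at hp ⊢
      refine ⟨by simpa using hp.1.ne, ?_⟩
      simp [gCol, max_eq_right hp.1.le, hp.2]
    · rintro ⟨a, b⟩ hp ⟨a', b'⟩ hp' h
      simp only [Finset.mem_filter, Finset.mem_univ, true_and] at hp hp'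
      rcases Sym2.eq_iff.mp h with ⟨h, h'⟩ | ⟨h, h'⟩
      · simp_all
      · simp only at h h'
        subst h h'
        exact absurd hp.1 (lt_asymm hp'.1)
    · intro e he
      induction e using Sym2.ind with
      | _ a b =>
      replace he := (Finset.mem_filter.mp he).2
      simp only [Sym2.mk_isDiag_iff, gCol, Sym2.lift_mk] at he
      rcases lt_or_gt_of_ne he.1 with h | h
      · refine ⟨(a, b), ?_, rfl⟩
        simpa [h, max_eq_right h.le] using he.2
      · refine ⟨(b, a), ?_, Sym2.eq_swap⟩
        simpa [h, max_eq_left h.le] using he.2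
  rw [h1, Finset.card_filter, Fintype.sum_prod_type_right]
  refine Finset.sum_congr rfl fun v _ => ?_
  by_cases hv : g v = i
  · simp only [hv, and_true, if_true]
    rw [← Finset.card_filter]
    have : Finset.univ.filter (fun x : Fin n => x < v) = Finset.Iio v := by ext; simp
    rw [this, Fin.card_Iio]
  · simp [hv]

lemma gFinal {n : ℕ} (hn : 1 ≤ n) {M : Multiset ℕ} (h : GPack (GI 1 n) M)
    (hs : (GI 1 n).sum = M.sum) (hk : 1 ≤ M.card) {s : ℕ} (hM : ∀ x ∈ M, x = s ∨ x = s + 1) :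
    ∃ c : Sym2 (Fin n) → Fin M.card, IsGallai c ∧
      ∀ i j : Fin M.card, colorCard c i ≤ colorCard c j + 1 := by
  obtain ⟨f, hf1, hf2⟩ := gFun h hs
  let g : Fin n → Fin M.card := fun v => if hv : f v < M.card then ⟨f v, hv⟩ else ⟨0, hk⟩
  have key : ∀ i, colorCard (gCol g) i ∈ M := by
    intro i
    rw [gCol_card]
    convert hf2 i i.2 using 1
    have h1 : ∀ v : Fin n, (if g v = i then (v : ℕ) else 0) =
        (fun x : ℕ => if f x = i then x else 0) v := by
      intro v
      rcases Nat.eq_zero_or_pos (v : ℕ) with h0 | h0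
      · simp [h0]
      · have := hf1 v (Finset.mem_Ico.mpr ⟨h0, v.2⟩)
        simp [g, this, Fin.ext_iff]
    rw [Finset.sum_congr rfl (fun v _ => h1 v), Fin.sum_univ_eq_sum_range (fun x : ℕ => if f x = i then x else 0) n, Finset.range_eq_Ico,
      Finset.sum_eq_sum_Ico_succ_bot (by omega)]
    simp
  refine ⟨gCol g, gCol_gallai g, fun i j => ?_⟩
  have := hM _ (key i)
  have := hM _ (key j)
  omega

theorem exists_balanced_gallai (n k : ℕ) (hn : 1 ≤ n) (hk : 1 ≤ k) (hkn : k ≤ (n + 1) / 2) :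
    ∃ c : Sym2 (Fin n) → Fin k, IsGallai c ∧
      ∀ i j : Fin k, colorCard c i ≤ colorCard c j + 1 := by
  obtain ⟨m, rfl⟩ : ∃ m, n = m + 1 := ⟨n - 1, by omega⟩
  suffices ∃ q p s : ℕ, q + p = k ∧ 2 * (q * s + p * (s+1)) = m * (m+1) ∧
      GPack (GI 1 (m+1)) (Multiset.replicate q s + Multiset.replicate p (s+1)) by
    obtain ⟨q, p, s, rfl, hT, h⟩ := this
    have hc : (Multiset.replicate q s + Multiset.replicate p (s+1)).card = q + p := by simp
    have := gFinal hn h (by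
      have := GI_sum m
      simp only [Multiset.sum_add, Multiset.sum_replicate, smul_eq_mul]
      omega) (by omega) (s := s) (by
        intro x hx
        rcases Multiset.mem_add.mp hx with hx | hx
        · exact Or.inl (Multiset.eq_of_mem_replicate hx)
        · exact Or.inr (Multiset.eq_of_mem_replicate hx))
    rwa [hc] at this
  rcases le_or_gt (2 * k) (m + 1) with h2 | h2
  · have hS := GI_sum m
    set S := (GI 1 (m+1)).sum
    have hd := Nat.div_add_mod S k
    have hlt := Nat.mod_lt S hk
    set s := S / k
    set p := S % k
    obtain ⟨q, hq⟩ : ∃ q, k = q + p := ⟨k - p, by omega⟩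
    have hT : 2 * (q * s + p * (s+1)) = m * (m+1) := by
      rw [← hS, ← hd, hq]; ring
    refine ⟨q, p, s, hq.symm, hT, gBal m q p s ?_ hT⟩
    by_contra hcon
    push Not at hcon
    nlinarith
  · obtain ⟨j, rfl⟩ : ∃ j, k = j + 1 := ⟨k - 1, by omega⟩
    obtain rfl : m = 2 * j := by omega
    rcases Nat.eq_zero_or_pos j with rfl | hj
    · exact ⟨1, 0, 0, by simp, by simp, GPack.zeros _ 1⟩
    obtain ⟨t, rfl⟩ : ∃ t, j = t + 1 := ⟨j - 1, by omega⟩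
    refine ⟨t + 1, 1, 2 * t + 1, rfl, by ring, ?_⟩
    have h := gE (2*t+1) (t+1) (2*t+1) le_rfl (by nlinarith)
    have h' := h.add (GPack.self {2*t+2})
    rw [← GI_single, GI_add (by omega) (by omega), GI_single, Multiset.sum_singleton] at h'
    exact h'
end

section
/- Let n, p, k, q be nonnegative integers with p ≥ n-1 and n(n-1)/2 = k·p + q. Then K_n admits a Gallai (k+1)-coloring in which k of the color classes have exactly p edges and the remaining color class has exactly q edges. -/
/-- `S` contains `k` pairwise disjoint subsets with sum `p`. -/
def HasParts (S : Finset ℕ) (p k : ℕ) : Prop :=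
  ∃ A : ℕ → Finset ℕ, (∀ j < k, A j ⊆ S) ∧ (∀ i < k, ∀ j < k, i ≠ j → Disjoint (A i) (A j)) ∧
    ∀ j < k, ∑ x ∈ A j, x = p

lemma HasParts.mono {S T : Finset ℕ} {p k l : ℕ} (h : HasParts S p k) (hST : S ⊆ T)
    (hl : l ≤ k) : HasParts T p l := by
  obtain ⟨A, h1, h2, h3⟩ := h
  exact ⟨A, fun j hj => (h1 j (by omega)).trans hST,
    fun i hi j hj => h2 i (by omega) j (by omega), fun j hj => h3 j (by omega)⟩

lemma HasParts.zero (S : Finset ℕ) (p : ℕ) : HasParts S p 0 :=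
  ⟨fun _ => ∅, by simp, by simp, by simp⟩

lemma HasParts.single {S : Finset ℕ} {p : ℕ} (h : p ∈ S) : HasParts S p 1 :=
  ⟨fun _ => {p}, by simpa using h, by intro i hi j hj; omega, by simp⟩

lemma HasParts.add {S T : Finset ℕ} {p k l : ℕ} (h : HasParts S p k) (h' : HasParts T p l)
    (hd : Disjoint S T) : HasParts (S ∪ T) p (k + l) := by
  obtain ⟨A, h1, h2, h3⟩ := h
  obtain ⟨B, g1, g2, g3⟩ := h'
  refine ⟨fun j => if j < k then A j else B (j - k), ?_, ?_, ?_⟩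
  · intro j hj
    dsimp only
    split_ifs with hjk
    · exact (h1 j hjk).trans Finset.subset_union_left
    · exact (g1 _ (by omega)).trans Finset.subset_union_right
  · intro i hi j hj hij
    dsimp only
    split_ifs with ha hb hb
    · exact h2 i ha j hb hij
    · exact hd.mono (h1 i ha) (g1 _ (by omega))
    · exact (hd.mono (h1 j hb) (g1 _ (by omega))).symm
    · exact g2 _ (by omega) _ (by omega) (by omega)
  · intro j hj
    dsimp only
    split_ifs with hjk
    · exact h3 j hjk
    · exact g3 _ (by omega)

lemma HasParts.layer {S T : Finset ℕ} {p p' k : ℕ} (h : HasParts S p k) (h' : HasParts T p' k)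
    (hd : Disjoint S T) : HasParts (S ∪ T) (p + p') k := by
  obtain ⟨A, h1, h2, h3⟩ := h
  obtain ⟨B, g1, g2, g3⟩ := h'
  refine ⟨fun j => A j ∪ B j, ?_, ?_, ?_⟩
  · intro j hj
    exact Finset.union_subset_union (h1 j hj) (g1 j hj)
  · intro i hi j hj hij
    simp only [Finset.disjoint_union_left, Finset.disjoint_union_right]
    exact ⟨⟨h2 i hi j hj hij, (hd.mono (h1 j hj) (g1 i hi)).symm⟩,
      hd.mono (h1 i hi) (g1 j hj), g2 i hi j hj hij⟩
  · intro j hj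
    dsimp only
    rw [Finset.sum_union (hd.mono (h1 j hj) (g1 j hj)), h3 j hj, g3 j hj]

lemma HasParts.merge {S : Finset ℕ} {r k : ℕ} (h : HasParts S r (2 * k)) :
    HasParts S (2 * r) k := by
  obtain ⟨A, h1, h2, h3⟩ := h
  refine ⟨fun j => A (2 * j) ∪ A (2 * j + 1), ?_, ?_, ?_⟩
  · intro j hj
    exact Finset.union_subset (h1 _ (by omega)) (h1 _ (by omega))
  · intro i hi j hj hij
    simp only [Finset.disjoint_union_left, Finset.disjoint_union_right]
    refine ⟨⟨?_, ?_⟩, ?_, ?_⟩ <;> exact h2 _ (by omega) _ (by omega) (by omega)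
  · intro j hj
    dsimp only
    rw [Finset.sum_union (h2 _ (by omega) _ (by omega) (by omega)), h3 _ (by omega),
      h3 _ (by omega)]
    omega

lemma HasParts.pairs {S : Finset ℕ} {a b t : ℕ} (h : a + 2 * t ≤ b + 1)
    (hS : ∀ j < t, a + j ∈ S ∧ b - j ∈ S) : HasParts S (a + b) t := by
  refine ⟨fun j => {a + j, b - j}, ?_, ?_, ?_⟩
  · intro j hj x hx
    simp only [Finset.mem_insert, Finset.mem_singleton] at hx
    rcases hx with rfl | rfl
    · exact (hS j hj).1
    · exact (hS j hj).2
  · intro i hi j hj hij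
    rw [Finset.disjoint_left]
    intro x hx hy
    simp only [Finset.mem_insert, Finset.mem_singleton] at hx hy
    omega
  · intro j hj
    dsimp only
    rw [Finset.sum_pair (by omega)]
    omega

lemma disjoint_Icc_low {M : ℕ} {T : Finset ℕ} (h : ∀ x ∈ T, M < x) :
    Disjoint (Finset.Icc 1 M) T := by
  rw [Finset.disjoint_left]
  intro x hx hy
  have := h x hy
  simp at hx
  omega

lemma hasParts_main (N : ℕ) : ∀ p k : ℕ, N ≤ p → 2 * (k * p) ≤ N * (N + 1) →
    HasParts (Finset.Icc 1 N) p k := by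
  induction N using Nat.strong_induction_on with
  | _ N ih =>
  intro p k hp hk
  -- weakened form of the induction hypothesis
  have ih' : ∀ M < N, ∀ p k : ℕ, (M ≤ p ∨ (M ≤ p + 1 ∧ 2 * (k * p) + 2 * M ≤ M * (M + 1))) →
      2 * (k * p) ≤ M * (M + 1) → HasParts (Finset.Icc 1 M) p k := by
    intro M hM p k h1 h2
    rcases h1 with h1 | ⟨h1, h3⟩
    · exact ih M hM p k h1 h2
    · rcases M with _ | M
      · exact ih 0 hM p k (by omega) h2
      · refine (ih M (by omega) p k (by omega) ?_).mono
          (Finset.Icc_subset_Icc le_rfl (by omega)) le_rfl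
        nlinarith
  rcases Nat.eq_zero_or_pos k with rfl | hk0
  · exact HasParts.zero _ _
  rcases Nat.eq_zero_or_pos N with rfl | hN0
  · have hp0 : p = 0 := by
      rcases Nat.eq_zero_or_pos p with h | h
      · exact h
      · have := Nat.mul_pos hk0 h
        omega
    subst hp0
    exact ⟨fun _ => ∅, by simp, by simp, by simp⟩
  obtain ⟨M, rfl⟩ : ∃ M, N = M + 1 := ⟨N - 1, by omega⟩
  by_cases hq : 2 * (k * p) ≤ M * (M + 1)
  · exact (ih M (by omega) p k (by omega) hq).mono
      (Finset.Icc_subset_Icc le_rfl (by omega)) le_rfl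
  push Not at hq
  rcases Nat.eq_or_lt_of_le hp with rfl | hp1
  · -- p = N
    obtain ⟨l, rfl⟩ : ∃ l, k = l + 1 := ⟨k - 1, by omega⟩
    have h1 := ih M (by omega) (M + 1) l (by omega) (by nlinarith)
    have h2 : HasParts {M + 1} (M + 1) 1 := HasParts.single (by simp)
    refine (h1.add h2 (disjoint_Icc_low (by simp))).mono ?_ le_rfl
    intro x hx
    simp at hx ⊢
    omega
  rcases Nat.lt_or_ge p (2 * (M + 1)) with hp2 | hp2
  · -- N < p < 2N
    obtain ⟨L, rfl⟩ : ∃ L, p = M + 1 + L + 1 := ⟨p - (M + 2), by omega⟩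
    -- elements L+1, ..., M+1 are paired
    obtain ⟨t, ht⟩ : ∃ t, M + 1 - L = 2 * t ∨ M + 1 - L = 2 * t + 1 :=
      ⟨(M + 1 - L) / 2, by omega⟩
    rcases Nat.lt_or_ge t k with htk | htk
    swap
    · have h1 : HasParts (Finset.Icc 1 (M + 1)) (L + 1 + (M + 1)) t := by
        apply HasParts.pairs
        · omega
        · intro j hj
          simp
          omega
      have e : M + 1 + L + 1 = L + 1 + (M + 1) := by omega
      rw [e]
      exact h1.mono le_rfl htk
    obtain ⟨l, rfl⟩ : ∃ l, k = t + l := ⟨k - t, by omega⟩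
    have e : M + 1 + L + 1 = L + 1 + (M + 1) := by omega
    rcases ht with ht | ht
    · have hM : M = L + 2 * t - 1 := by omega
      have h1 : HasParts (Finset.Icc (L + 1) (M + 1)) (L + 1 + (M + 1)) t := by
        apply HasParts.pairs
        · omega
        · intro j hj
          simp
          omega
      have h2 := ih L (by omega) (L + 1 + (M + 1)) l (by omega) (by
        have : M + 1 = L + 2 * t := by omega
        rw [e, this] at hk
        rw [this]
        nlinarith)
      rw [e, Nat.add_comm t l]
      refine (h2.add h1 (disjoint_Icc_low (by intro x hx; simp at hx; omega))).mono ?_ le_rfl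
      intro x hx
      simp at hx ⊢
      omega
    · have hM : M = L + 2 * t := by omega
      subst hM
      have h1 : HasParts ((Finset.Icc (L + 1) (L + 2 * t + 1)).erase (L + t + 1))
          (L + 1 + (L + 2 * t + 1)) t := by
        apply HasParts.pairs
        · omega
        · intro j hj
          simp
          omega
      have h2 := ih L (by omega) (L + t + 1) (2 * l - 1) (by omega) (by
        obtain ⟨m, rfl⟩ : ∃ m, l = m + 1 := ⟨l - 1, by omega⟩
        have : 2 * (m + 1) - 1 = 2 * m + 1 := by omega
        rw [this]
        nlinarith)
      have h3 : HasParts {L + t + 1} (L + t + 1) 1 := HasParts.single (by simp)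
      have h4 := h2.add h3 (disjoint_Icc_low (by intro x hx; simp at hx; omega))
      have e2 : 2 * l - 1 + 1 = 2 * l := by omega
      rw [e2] at h4
      have h5 := h4.merge
      have e3 : 2 * (L + t + 1) = L + 1 + (L + 2 * t + 1) := by omega
      rw [e3] at h5
      rw [e, Nat.add_comm t l]
      refine (h5.add h1 ?_).mono ?_ le_rfl
      · rw [Finset.disjoint_left]
        intro x hx
        simp at hx ⊢
        omega
      · intro x hx
        simp at hx ⊢
        omega
  · -- p ≥ 2N
    have h4k : 4 * k ≤ M + 2 := by
      have : k * (2 * (M + 1)) ≤ k * p := Nat.mul_le_mul_left _ hp2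
      have : (4 * k) * (M + 1) ≤ (M + 2) * (M + 1) := by nlinarith
      exact Nat.le_of_mul_le_mul_right this (by omega)
    obtain ⟨R, hR⟩ : ∃ R, M + 1 = R + 2 * k := ⟨M + 1 - 2 * k, by omega⟩
    obtain ⟨s, rfl⟩ : ∃ s, p = s + (R + 1 + (M + 1)) := ⟨p - (R + 1 + (M + 1)), by omega⟩
    have hsum : 2 * (k * s) ≤ R * (R + 1) := by
      rw [hR] at hk
      nlinarith
    have hlow : (R + 2 * k) * (R + 2 * k) < 2 * (k * (s + (R + 1 + (R + 2 * k)))) + (R + 2 * k) := by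
      rw [← hR]
      nlinarith
    have hsR : R ≤ s ∨ (R ≤ s + 1 ∧ 2 * (k * s) + 2 * R ≤ R * (R + 1)) := by
      by_contra hcon
      push Not at hcon
      obtain ⟨c1, c2⟩ := hcon
      -- s ≥ 2k - 1 and R ≥ 2k - 1
      have hs1 : 2 * k ≤ s + 1 := by omega
      have hlow' : R * R < 2 * (k * s) + R + 4 * k := by nlinarith
      rcases Nat.lt_or_ge (s + 1) R with hc | hc
      · obtain ⟨u, rfl⟩ : ∃ u, R = u + 1 := ⟨R - 1, by omega⟩
        have a1 : k * (s + 2) ≤ k * (u + 1) := Nat.mul_le_mul_left _ (by omega)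
        have a2 : (2 * k) * (u + 1) ≤ u * (u + 1) := Nat.mul_le_mul_right _ (by omega)
        nlinarith
      · have c3 := c2 hc
        obtain rfl : R = s + 1 := by omega
        have a2 : (2 * k) * s ≤ (s + 1) * s := Nat.mul_le_mul_right _ (by omega)
        nlinarith
    have h1 := ih' R (by omega) s k hsR hsum
    have h2 : HasParts (Finset.Icc (R + 1) (M + 1)) (R + 1 + (M + 1)) k := by
      apply HasParts.pairs
      · omega
      · intro j hj
        simp
        omega
    refine (h1.layer h2 (disjoint_Icc_low (by intro x hx; simp at hx; omega))).mono ?_ le_rfl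
    intro x hx
    simp at hx ⊢
    omega


lemma card_fiber {n : ℕ} (v : Fin n) :
    (Finset.univ.filter (fun e : Sym2 (Fin n) => ¬ e.IsDiag ∧ e.sup = v)).card = v.1 := by
  have : (Finset.univ.filter (fun e : Sym2 (Fin n) => ¬ e.IsDiag ∧ e.sup = v)) =
      (Finset.Iio v).image (fun u => s(u, v)) := by
    ext e
    induction e using Sym2.ind with
    | _ a b =>
    simp only [Finset.mem_filter, Finset.mem_univ, true_and, Sym2.mk_isDiag_iff, Sym2.sup_mk,
      Finset.mem_image, Finset.mem_Iio]
    constructor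
    · rintro ⟨hab, rfl⟩
      rcases lt_or_gt_of_ne hab with h | h
      · exact ⟨a, by simpa using h, by simp [sup_eq_right.2 h.le]⟩
      · exact ⟨b, by simpa using h, by rw [sup_eq_left.2 h.le, Sym2.eq_swap]⟩
    · rintro ⟨u, hu, h⟩
      rw [Sym2.eq_iff] at h
      rcases h with ⟨rfl, rfl⟩ | ⟨rfl, rfl⟩
      · exact ⟨hu.ne, sup_eq_right.2 hu.le⟩
      · exact ⟨hu.ne', sup_eq_left.2 hu.le⟩
  rw [this, Finset.card_image_of_injOn, Fin.card_Iio]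
  intro a _ b _ h
  have h' : a = b ∨ a = v ∧ v = b := by simpa using h
  rcases h' with h' | ⟨h1, h2⟩
  · exact h'
  · exact h1.trans h2

lemma colorCard_sup {n : ℕ} {C : Type*} [DecidableEq C] (g : Fin n → C) (i : C) :
    colorCard (fun e : Sym2 (Fin n) => g e.sup) i =
      ∑ v ∈ Finset.univ.filter (fun v : Fin n => g v = i), v.1 := by
  unfold colorCard
  rw [Finset.card_eq_sum_card_fiberwise (f := fun e : Sym2 (Fin n) => e.sup)
    (t := Finset.univ.filter (fun v : Fin n => g v = i))]
  · refine Finset.sum_congr rfl fun v hv => ?_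
    rw [← card_fiber v, Finset.filter_filter]
    congr 1
    ext e
    simp only [Finset.mem_filter, Finset.mem_univ, true_and] at hv ⊢
    constructor
    · rintro ⟨⟨h1, _⟩, h2⟩
      exact ⟨h1, h2⟩
    · rintro ⟨h1, h2⟩
      exact ⟨⟨h1, by rw [h2, hv]⟩, h2⟩
  · intro e he
    simp at he ⊢
    exact he.2

lemma isGallai_sup {n : ℕ} {C : Type*} (g : Fin n → C) :
    IsGallai (fun e : Sym2 (Fin n) => g e.sup) := by
  intro a b d hab hbd had
  simp only [Sym2.sup_mk]
  rcases le_total a b with h1 | h1 <;> rcases le_total b d with h2 | h2 <;>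
    rcases le_total a d with h3 | h3 <;> simp [h1, h2, h3]
  · exact absurd (le_antisymm h1 (h2.trans h3)) hab
  · exact absurd (le_antisymm h1 (h3.trans h2)).symm hab

/-- If `p ≥ n-1` and `n(n-1)/2 = k·p + q`, then `K_n` admits a Gallai `(k+1)`-coloring
with `k` color classes of size `p` and one color class of size `q`. -/
theorem gallai_div_coloring (n p k q : ℕ) (hp : n - 1 ≤ p)
    (hsum : n * (n - 1) / 2 = k * p + q) :
    ∃ c : Sym2 (Fin n) → Fin (k + 1), IsGallai c ∧
      (∀ i : Fin (k + 1), i.1 < k → colorCard c i = p) ∧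
      colorCard c (Fin.last k) = q := by
  have h2 : n * (n - 1) = 2 * (k * p + q) := by
    rw [← hsum, Nat.mul_div_cancel' (Nat.even_mul_pred_self n).two_dvd]
  have hle : 2 * (k * p) ≤ (n - 1) * (n - 1 + 1) := by
    rcases n with _ | n
    · simp at h2 ⊢
      omega
    · simp only [Nat.add_sub_cancel] at h2 ⊢
      nlinarith
  obtain ⟨A, hA1, hA2, hA3⟩ := hasParts_main (n - 1) p k hp hle
  classical
  let g : Fin n → Fin (k + 1) := fun v =>
    if h : ∃ j : Fin k, v.1 ∈ A j then (Classical.choose h).castSucc else Fin.last k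
  have hg : ∀ (v : Fin n) (j : Fin k), g v = j.castSucc ↔ v.1 ∈ A j := by
    intro v j
    by_cases h : ∃ j : Fin k, v.1 ∈ A j
    · have hs := Classical.choose_spec h
      have e : g v = (Classical.choose h).castSucc := dif_pos h
      rw [e, Fin.castSucc_inj]
      constructor
      · intro h'
        rw [← h']
        exact hs
      · intro h'
        by_contra hne
        exact Finset.disjoint_left.1 (hA2 _ (Classical.choose h).2 _ j.2
          (fun hh => hne (Fin.ext hh))) hs h'
    · have e : g v = Fin.last k := dif_neg h
      rw [e]
      constructor
      · intro h'
        exact absurd h'.symm (Fin.castSucc_lt_last j).ne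
      · intro h'
        exact absurd ⟨j, h'⟩ h
  have hcol : ∀ j : Fin k, colorCard (fun e : Sym2 (Fin n) => g e.sup) j.castSucc = p := by
    intro j
    rw [colorCard_sup, ← hA3 j j.2]
    refine Finset.sum_bij (fun v _ => v.1) ?_ ?_ ?_ ?_
    · intro v hv
      exact (hg v j).1 (by simpa using hv)
    · intro a _ b _ h
      exact Fin.ext h
    · intro x hx
      have hx' := hA1 j j.2 hx
      simp only [Finset.mem_Icc] at hx'
      exact ⟨⟨x, by omega⟩, by simpa using (hg ⟨x, by omega⟩ j).2 hx, rfl⟩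
    · intro v _
      rfl
  refine ⟨fun e => g e.sup, isGallai_sup g, ?_, ?_⟩
  · intro i hi
    exact hcol ⟨i.1, hi⟩
  · have htot : ∑ i : Fin (k + 1), colorCard (fun e : Sym2 (Fin n) => g e.sup) i =
        n * (n - 1) / 2 := by
      simp only [colorCard_sup]
      rw [Finset.sum_fiberwise, Fin.sum_univ_eq_sum_range (fun i => i) n, Finset.sum_range_id]
    rw [Fin.sum_univ_castSucc, Finset.sum_congr rfl (fun j _ => hcol j), hsum] at htot
    simp at htot
    exact htot
end

section
/- For every k ≥ 3 and every n ≥ 8k² + 1, every sequence e_1 ≥ ... ≥ e_k of positive integers with e_1 + ... + e_k = n(n-1)/2 is realizable as the color distribution of a Gallai k-coloring of K_n. -/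
/-- Triangular numbers `0 + 1 + ... + (n-1)`. -/
def triNum (n : ℕ) : ℕ := ∑ i ∈ Finset.range n, i

theorem triNum_succ (n : ℕ) : triNum (n + 1) = triNum n + n := by
  simp [triNum, Finset.sum_range_succ]

theorem triNum_two (n : ℕ) : 2 * triNum n + n = n * n := by
  induction n with
  | zero => simp [triNum]
  | succ n ih => rw [triNum_succ]; nlinarith

theorem triNum_mono {a b : ℕ} (h : a ≤ b) : triNum a ≤ triNum b := by
  induction b, h using Nat.le_induction with
  | base => exact le_rfl
  | succ b _ ih => rw [triNum_succ]; omega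

/-- Edges `i < j < n` of color `x`. -/
def cnt {C : Type} [DecidableEq C] (f : ℕ → ℕ → C) (n : ℕ) (x : C) : ℕ :=
  ∑ j ∈ Finset.range n, ((Finset.range j).filter (fun i => f i j = x)).card

def Gal {C : Type} (f : ℕ → ℕ → C) (n : ℕ) : Prop :=
  ∀ i j l, i < j → j < l → l < n → f i j = f j l ∨ f j l = f i l ∨ f i j = f i l

theorem cnt_succ {C : Type} [DecidableEq C] (f : ℕ → ℕ → C) (n : ℕ) (x : C) :
    cnt f (n + 1) x = cnt f n x + ((Finset.range n).filter (fun i => f i n = x)).card := by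
  simp [cnt, Finset.sum_range_succ]

theorem sum_cnt {C : Type} [DecidableEq C] [Fintype C] (f : ℕ → ℕ → C) (n : ℕ) :
    ∑ x, cnt f n x = triNum n := by
  unfold cnt triNum
  rw [Finset.sum_comm]
  refine Finset.sum_congr rfl fun j _ => ?_
  have := Finset.card_eq_sum_card_fiberwise (f := fun i => f i j) (s := Finset.range j)
    (t := Finset.univ) (by intro x _; simp)
  rw [Finset.card_range] at this
  exact this.symm

/-- The extension. -/
def extCol {C : Type} (f : ℕ → ℕ → C) (m' m r : ℕ) (x g : C) (i j : ℕ) : C :=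
  if j < m' then f i j
  else if j < m then
    (if m' ≤ i ∧ triNum (j - m') + (i - m') < r then x else g)
  else x

theorem ext_gal {C : Type} (f : ℕ → ℕ → C) (m' m r n : ℕ) (x g : C) (hf : Gal f m') :
    Gal (extCol f m' m r x g) n := by
  intro i j l hij hjl _
  by_cases h1 : l < m'
  · have := hf i j l hij hjl h1
    have h2 : j < m' := by omega
    simpa [extCol, h1, h2] using this
  by_cases h2 : l < m
  · by_cases h3 : j < m'
    · have h4 : ¬ m' ≤ i := by omega
      have h5 : ¬ m' ≤ j := by omega
      simp [extCol, h1, h2, h4, h5]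
    · have h6 : j < m := by omega
      simp only [extCol, h1, h2, h3, h6, if_true, if_false]
      split_ifs <;> simp
  · simp [extCol, h1, h2]

theorem ext_cnt_low {C : Type} [DecidableEq C] (f : ℕ → ℕ → C) (m' m r : ℕ) (x g y : C) :
    cnt (extCol f m' m r x g) m' y = cnt f m' y := by
  unfold cnt
  refine Finset.sum_congr rfl fun j hj => ?_
  have : j < m' := by simpa using hj
  simp [extCol, this]

theorem ext_cnt_other {C : Type} [DecidableEq C] (f : ℕ → ℕ → C) (m' m r : ℕ) (x g y : C)
    (hx : x ≠ y) (hg : g ≠ y) (n : ℕ) (hn : m' ≤ n) :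
    cnt (extCol f m' m r x g) n y = cnt f m' y := by
  induction n, hn using Nat.le_induction with
  | base => exact ext_cnt_low ..
  | succ n hn ih =>
    rw [cnt_succ, ih]
    have : ¬ n < m' := by omega
    simp only [Nat.add_eq_left, Finset.card_eq_zero, Finset.filter_eq_empty_iff]
    intro i _
    simp only [extCol, this, if_false]
    split_ifs <;> assumption

theorem ext_cnt_mid {C : Type} [DecidableEq C] (f : ℕ → ℕ → C) (m' m r : ℕ) (x g : C)
    (hg : g ≠ x) (s : ℕ) (hs : m' + s ≤ m) :
    cnt (extCol f m' m r x g) (m' + s) x = cnt f m' x + min r (triNum s) := by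
  induction s with
  | zero => simpa [triNum] using ext_cnt_low ..
  | succ s ih =>
    rw [← add_assoc, cnt_succ, ih (by omega), triNum_succ]
    have h1 : m' + s < m := by omega
    have : (Finset.range (m' + s)).filter (fun i => extCol f m' m r x g i (m' + s) = x)
        = Finset.Ico m' (m' + min s (r - triNum s)) := by
      ext i
      rw [Finset.mem_filter, Finset.mem_range, Finset.mem_Ico]
      simp only [extCol, h1, if_true, show ¬ (m' + s < m') by omega, if_false, Nat.add_sub_cancel_left]
      split_ifs with h <;> simp [hg] <;> omega
    rw [this, Nat.card_Ico]
    omega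

theorem ext_cnt_top {C : Type} [DecidableEq C] (f : ℕ → ℕ → C) (m' m r : ℕ) (x g : C)
    (hm : m' ≤ m) (n : ℕ) (hn : m ≤ n) :
    cnt (extCol f m' m r x g) n x + triNum m = cnt (extCol f m' m r x g) m x + triNum n := by
  induction n, hn using Nat.le_induction with
  | base => rfl
  | succ n hn ih =>
    rw [cnt_succ, triNum_succ]
    have h1 : ¬ n < m' := by omega
    have h2 : ¬ n < m := by omega
    simp [extCol, h1, h2]
    omega

theorem num_a {j m s : ℕ} (hj : 1 ≤ j) (hm : 8 * j * (j + 1) + 1 ≤ m)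
    (hs : s * s + 8 ≤ 2 * m + 3 * s ) : 8 * j ^ 2 + 1 + s ≤ m := by
  by_contra h
  obtain ⟨u, rfl⟩ := Nat.exists_eq_add_of_le hm
  have h1 : 8 * j + 1 + u ≤ s := by nlinarith
  obtain ⟨v, rfl⟩ := Nat.exists_eq_add_of_le h1
  nlinarith [Nat.zero_le (u * v), Nat.zero_le (j * v), Nat.zero_le (j * u), mul_le_mul hj hj]

theorem num_b {j m s : ℕ} (hj : 1 ≤ j) (hm : 8 * j * (j + 1) + 1 ≤ m)
    (hs : s * s + 8 ≤ 2 * m + 3 * s ) : 2 * j * s ≤ m := by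
  by_contra h
  have h1 : s ≤ 4 * j + 2 := by
    by_contra h2
    nlinarith
  nlinarith

set_option maxHeartbeats 2000000 in
theorem main_step {C : Type} [DecidableEq C] [Fintype C] (j : ℕ) :
    ∀ (S : Finset C) (n : ℕ) (e : C → ℕ), S.card = j + 1 → 8 * (j + 1) ^ 2 + 1 ≤ n →
      (∀ x, x ∉ S → e x = 0) → ∑ x, e x = triNum n →
      ∃ f : ℕ → ℕ → C, Gal f n ∧ ∀ x, cnt f n x = e x := by
  induction j with
  | zero =>
    intro S n e hS hn he hsum
    obtain ⟨x, rfl⟩ := Finset.card_eq_one.1 hS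
    refine ⟨fun _ _ => x, fun _ _ _ _ _ _ => Or.inl rfl, fun y => ?_⟩
    by_cases h : x = y
    · subst h
      rw [Finset.sum_eq_single x (fun b _ hb => he b (by simpa using hb)) (by simp)] at hsum
      simp [cnt, hsum, triNum]
    · rw [he y (by simpa using fun h' => h h'.symm)]
      simp [cnt, h]
  | succ p ih =>
    intro S n e hS hn he hsum
    obtain ⟨j, rfl⟩ : ∃ j, j = p + 1 := ⟨_, rfl⟩
    have hSsum : ∑ x ∈ S, e x = triNum n := by
      rw [← hsum]
      exact Finset.sum_subset (Finset.subset_univ _) (fun x _ hx => he x hx)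
    have hSne : S.Nonempty := by rw [← Finset.card_pos]; omega
    obtain ⟨x, hxS, hxmin⟩ := Finset.exists_min_image S e hSne
    have hx : (p + 2) * e x ≤ triNum n := by
      rw [← hSsum, show p + 2 = S.card by omega, ← smul_eq_mul]
      exact Finset.card_nsmul_le_sum _ _ _ hxmin
    have hersum : ∑ y ∈ S.erase x, e y + e x = triNum n := by
      rw [← hSsum, Finset.sum_erase_add _ _ hxS]
    have hercard : (S.erase x).card = p + 1 := by rw [Finset.card_erase_of_mem hxS]; omega
    obtain ⟨g, hgS, hgmax⟩ := Finset.exists_max_image (S.erase x) e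
      (by rw [← Finset.card_pos]; omega)
    have hg : ∑ y ∈ S.erase x, e y ≤ (p + 1) * e g := by
      rw [← hercard, ← smul_eq_mul]
      exact Finset.sum_le_card_nsmul _ _ _ hgmax
    obtain ⟨hgx, hgS'⟩ := Finset.mem_erase.1 hgS
    set A := ∑ y ∈ S.erase x, e y with hA
    have hTn := triNum_two n
    have hex : ∃ m, A ≤ triNum m := ⟨n, by omega⟩
    obtain ⟨m, hm1, hm2⟩ : ∃ m, A ≤ triNum m ∧ ∀ m0 < m, triNum m0 < A :=
      ⟨Nat.find hex, Nat.find_spec hex, fun m0 h => by simpa using Nat.find_min hex h⟩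
    have hmn : m ≤ n := by
      by_contra h
      have := hm2 n (by omega)
      omega
    obtain ⟨r, hr⟩ := Nat.exists_eq_add_of_le hm1
    have hTm := triNum_two m
    have hApos : 0 < A := by nlinarith
    have hmpos : 0 < m := by
      rcases Nat.eq_zero_or_pos m with h | h
      · subst h; simp [triNum] at hm1; omega
      · exact h
    have hrm : r + 2 ≤ m := by
      obtain ⟨q, rfl⟩ : ∃ q, m = q + 1 := ⟨m - 1, by omega⟩
      have := hm2 q (by omega)
      rw [triNum_succ] at hr
      omega
    have hmk : (p + 1) * n ≤ (p + 2) * m := by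
      by_contra h
      have h1 : (p + 1) * triNum n ≤ (p + 2) * triNum m := by nlinarith
      have h2 : (p + 1) * (n * (n - 1)) ≤ (p + 2) * (m * (m - 1)) := by
        have a1 : n * (n - 1) = 2 * triNum n := by rw [Nat.mul_sub]; omega
        have a2 : m * (m - 1) = 2 * triNum m := by rw [Nat.mul_sub]; omega
        rw [a1, a2]; nlinarith
      have h3 : (p + 2) * m * (m - 1) < (p + 1) * n * (n - 1) := by
        refine Nat.mul_lt_mul_of_lt_of_le (by omega) (by omega) ?_
        omega
      nlinarith
    have hm8 : 8 * (p + 1) * (p + 2) + 1 ≤ m := by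
      by_contra h
      nlinarith
    have hex2 : ∃ s, r ≤ triNum s := ⟨m, by omega⟩
    obtain ⟨s, hs1, hs2⟩ : ∃ s, r ≤ triNum s ∧ ∀ s0 < s, triNum s0 < r :=
      ⟨Nat.find hex2, Nat.find_spec hex2, fun m0 h => by simpa using Nat.find_min hex2 h⟩
    have hTs := triNum_two s
    have hss : s * s + 8 ≤ 2 * m + 3 * s := by
      rcases Nat.eq_zero_or_pos s with h | h
      · subst h
        have : 1 ≤ (p + 1) * (p + 2) := Nat.mul_pos (by omega) (by omega)
        rw [mul_assoc] at hm8
        omega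
      · obtain ⟨q, rfl⟩ : ∃ q, s = q + 1 := ⟨s - 1, by omega⟩
        have := hs2 q (by omega)
        have := triNum_two q
        have e1 : (q + 1) * (q + 1) = q * q + 2 * q + 1 := by ring
        rw [e1]
        omega
    have ha := num_a (by omega) hm8 hss
    have hb := num_b (by omega) hm8 hss
    obtain ⟨m', rfl⟩ : ∃ m', m = m' + s := ⟨m - s, by omega⟩
    have hTm' := triNum_two m'
    obtain ⟨q, hq⟩ := Nat.exists_eq_add_of_le hs1
    have hsplit : triNum (m' + s) = triNum m' + s * m' + triNum s := by nlinarith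
    have hD : s * m' + q ≤ e g := by
      have h1 : (p + 1) * (s * m' + q) ≤ A := by
        have h2 : 2 * (p + 1) * s * (m' + s - 1) ≤ (m' + s) * (m' + s - 1) :=
          Nat.mul_le_mul_right _ hb
        have a2 : (m' + s) * (m' + s - 1) = 2 * triNum (m' + s) := by rw [Nat.mul_sub]; omega
        rw [a2] at h2
        have h3 : s * m' + triNum s ≤ s * (m' + s - 1) := by
          rcases Nat.eq_zero_or_pos s with h | h
          · subst h; simp [triNum]
          · obtain ⟨w, rfl⟩ : ∃ w, s = w + 1 := ⟨s - 1, by omega⟩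
            rw [show m' + (w + 1) - 1 = m' + w by omega]
            nlinarith
        have h4 : (p + 1) * (s * m' + triNum s) ≤ triNum (m' + s) := by
          have h5 := Nat.mul_le_mul_left (p + 1) h3
          have h6 : 2 * (p + 1) * s * (m' + s - 1) = 2 * ((p + 1) * (s * (m' + s - 1))) := by ring
          omega
        rw [hq, hr] at h4
        have h7 : (p + 1) * (s * m' + (r + q)) = (p + 1) * (s * m' + q) + p * r + r := by ring
        omega
      by_contra h
      push Not at h
      have := Nat.mul_lt_mul_of_pos_left h (show 0 < p + 1 by omega)
      omega
    let e' : C → ℕ := fun y => if y = x then 0 else if y = g then e g - (s * m' + q) else e y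
    have hsame : ∀ y ∈ (S.erase x).erase g, e' y = e y := by
      intro y hy
      simp only [Finset.mem_erase] at hy
      simp [e', hy.1, hy.2.1]
    have hzero : ∀ y, y ∉ S.erase x → e' y = 0 := by
      intro y hy
      by_cases h : y = x
      · simp [e', h]
      · have h1 : y ∉ S := fun h' => hy (Finset.mem_erase.2 ⟨h, h'⟩)
        have h2 : y ≠ g := fun h' => h1 (h' ▸ hgS')
        simp [e', h, h2, he y h1]
    have hnewsum : ∑ y, e' y = triNum m' := by
      rw [← Finset.sum_subset (Finset.subset_univ (S.erase x)) (fun y _ hy => hzero y hy),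
        ← Finset.sum_erase_add _ _ hgS]
      have h0 : ∑ y ∈ (S.erase x).erase g, e' y = ∑ y ∈ (S.erase x).erase g, e y :=
        Finset.sum_congr rfl hsame
      have h1 : ∑ y ∈ (S.erase x).erase g, e y + e g = A := Finset.sum_erase_add _ _ hgS
      have h2 : e' g = e g - (s * m' + q) := by simp [e', hgx]
      omega
    obtain ⟨f, hf1, hf2⟩ := ih (S.erase x) m' e' hercard (by omega) hzero hnewsum
    refine ⟨extCol f m' (m' + s) r x g, ext_gal _ _ _ _ _ _ _ hf1, ?_⟩
    have key : ∀ y, y ≠ g → cnt (extCol f m' (m' + s) r x g) n y = e y := by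
      intro y hy
      by_cases h : y = x
      · subst h
        have h1 := ext_cnt_top f m' (m' + s) r y g (by omega) n hmn
        have h2 := ext_cnt_mid f m' (m' + s) r y g hgx s le_rfl
        have h3 : e' y = 0 := by simp [e']
        rw [hf2, h3, min_eq_left hs1] at h2
        omega
      · rw [ext_cnt_other _ _ _ _ _ _ _ (Ne.symm h) (Ne.symm hy) n (by omega), hf2]
        simp [e', h, hy]
    intro y
    by_cases hy : y = g
    · subst hy
      have h1 := sum_cnt (extCol f m' (m' + s) r x y) n
      rw [← hsum, ← Finset.sum_erase_add _ _ (Finset.mem_univ y),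
        ← Finset.sum_erase_add _ _ (Finset.mem_univ y)] at h1
      have h0 : ∑ z ∈ Finset.univ.erase y, cnt (extCol f m' (m' + s) r x y) n z
          = ∑ z ∈ Finset.univ.erase y, e z :=
        Finset.sum_congr rfl (fun z hz => key z (Finset.ne_of_mem_erase hz))
      omega
    · exact key y hy

/-- Symmetric coloring from an ordered one. -/
def symCol {C : Type} (f : ℕ → ℕ → C) (n : ℕ) : Sym2 (Fin n) → C :=
  Sym2.lift ⟨fun a b => f (min a.1 b.1) (max a.1 b.1), fun a b => by
    simp only [min_comm, max_comm]⟩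

theorem symCol_mk {C : Type} (f : ℕ → ℕ → C) (n : ℕ) (a b : Fin n) :
    symCol f n s(a, b) = f (min a.1 b.1) (max a.1 b.1) := rfl

theorem symCol_lt {C : Type} (f : ℕ → ℕ → C) (n : ℕ) (a b : Fin n) (h : a < b) :
    symCol f n s(a, b) = f a.1 b.1 := by
  have : a.1 < b.1 := h
  rw [symCol_mk, min_eq_left this.le, max_eq_right this.le]

theorem symCol_gallai {C : Type} (f : ℕ → ℕ → C) (n : ℕ) (hf : Gal f n) :
    IsGallai (symCol f n) := by
  have key : ∀ a b d : Fin n, a < b → b < d →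
      symCol f n s(a, b) = symCol f n s(b, d) ∨ symCol f n s(b, d) = symCol f n s(a, d) ∨
      symCol f n s(a, b) = symCol f n s(a, d) := by
    intro a b d h1 h2
    rw [symCol_lt _ _ _ _ h1, symCol_lt _ _ _ _ h2, symCol_lt _ _ _ _ (h1.trans h2)]
    exact hf a b d h1 h2 d.2
  intro a b d h1 h2 h3
  have e1 : s(a, b) = s(b, a) := Sym2.eq_swap
  have e2 : s(b, d) = s(d, b) := Sym2.eq_swap
  have e3 : s(a, d) = s(d, a) := Sym2.eq_swap
  rcases lt_or_gt_of_ne h1 with h1 | h1 <;> rcases lt_or_gt_of_ne h2 with h2 | h2 <;>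
    rcases lt_or_gt_of_ne h3 with h3 | h3
  · exact key a b d h1 h2
  · exact absurd (h1.trans h2) (by order)
  · have := key a d b h3 h2; grind
  · have := key d a b h3 h1; grind
  · have := key b a d h1 h3; grind
  · have := key b d a h2 h3; grind
  · exact absurd (h2.trans h1) (by order)
  · have := key d b a h2 h1; grind

theorem symCol_card {C : Type} [DecidableEq C] (f : ℕ → ℕ → C) (n : ℕ) (x : C) :
    colorCard (symCol f n) x = cnt f n x := by
  unfold colorCard cnt
  rw [← Finset.card_sigma]
  symm
  refine Finset.card_bij
    (fun p hp => s(⟨p.2, ?_⟩, ⟨p.1, ?_⟩)) ?_ ?_ ?_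
  · simp only [Finset.mem_sigma, Finset.mem_range, Finset.mem_filter] at hp; omega
  · simp only [Finset.mem_sigma, Finset.mem_range, Finset.mem_filter] at hp; omega
  · rintro ⟨j, i⟩ hp
    simp only [Finset.mem_sigma, Finset.mem_range, Finset.mem_filter] at hp
    simp only [Finset.mem_filter, Finset.mem_univ, true_and]
    refine ⟨by simp; omega, ?_⟩
    rw [symCol_lt _ _ _ _ (by simpa using hp.2.1)]
    exact hp.2.2
  · rintro ⟨j, i⟩ hp ⟨j', i'⟩ hp' h
    simp only [Finset.mem_sigma, Finset.mem_range, Finset.mem_filter] at hp hp'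
    simp only [Sym2.eq_iff, Fin.mk.injEq] at h
    have h1 : j = j' := by omega
    have h2 : i = i' := by omega
    subst h1; subst h2; rfl
  · intro z
    induction z using Sym2.ind with
    | _ a b =>
      intro hz
      simp only [Finset.mem_filter, Finset.mem_univ, true_and, Sym2.mk_isDiag_iff] at hz
      rcases lt_or_gt_of_ne hz.1 with h | h
      · refine ⟨⟨b.1, a.1⟩, ?_, rfl⟩
        have := hz.2
        rw [symCol_lt _ _ _ _ h] at this
        simp only [Finset.mem_sigma, Finset.mem_range, Finset.mem_filter]
        exact ⟨b.2, h, this⟩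
      · refine ⟨⟨a.1, b.1⟩, ?_, Sym2.eq_swap⟩
        have := hz.2
        rw [Sym2.eq_swap, symCol_lt _ _ _ _ h] at this
        simp only [Finset.mem_sigma, Finset.mem_range, Finset.mem_filter]
        exact ⟨a.2, h, this⟩

/-- For `k ≥ 3` and `n ≥ 8k² + 1`, every decreasing sequence of `k` positive integers
summing to `C(n,2)` is realizable as the color distribution of a Gallai `k`-coloring
of `K_n`. -/
theorem gallai_all_realizable_large_n (n k : ℕ) (hk : 3 ≤ k) (hn : 8 * k ^ 2 + 1 ≤ n)
    (e : ℕ → ℕ) (hpos : ∀ i, i < k → 0 < e i)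
    (hdec : ∀ i j, i ≤ j → j < k → e j ≤ e i)
    (hsum : ∑ i ∈ Finset.range k, e i = n * (n - 1) / 2) :
    ∃ c : Sym2 (Fin n) → Fin k, IsGallai c ∧ ∀ i : Fin k, colorCard c i = e i.1 := by
  have hk1 : k = (k - 1) + 1 := by omega
  obtain ⟨f, hf1, hf2⟩ := main_step (k - 1) (Finset.univ : Finset (Fin k)) n (fun i => e i.1)
    (by simp; omega) (by rw [← hk1]; exact hn) (by simp) (by
      rw [Fin.sum_univ_eq_sum_range (fun i => e i) k, hsum]
      have h1 := triNum_two n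
      have h2 : n * (n - 1) = 2 * triNum n := by rw [Nat.mul_sub]; omega
      omega)
  exact ⟨symCol f n, symCol_gallai f n hf1, fun i => by rw [symCol_card, hf2]⟩
end
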